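/- arXiv:2010.09374 — 4 statements merged into one kernel-verified Lean document; each statement's English description precedes it below -/
import Mathlib

section
/- Let k be a field and K = k((t)) its field of formal Laurent series. Let P_1,…,P_n ∈ K[x_1,…,x_n] and let φ : K[y_1,…,y_n] → K[x_1,…,x_n] be the K-algebra homomorphism with φ(y_i) = P_i for all i. Assume φ is injective, that K[x_1,…,x_n] is a finitely generated module over the image of φ, and that the induced extension of fraction fields K(y_1,…,y_n) ⊆ K(x_1,…,x_n) is a separable field extension. Then the set of tuples (a_1,…,a_n) ∈ (k[[t]])^n with the following property is infinite: for every point x in K̄^n (K̄ an algebraic closure of K) satisfying P_i(x) = t·a_i for all i = 1,…,n, the Jacobian determinant det(∂P_i/∂x_j(x))_{i,j=1}^n is nonzero. -/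
open MvPolynomial

set_option maxHeartbeats 2000000
set_option synthInstance.maxHeartbeats 1000000

theorem Derivation.leibniz_eval₂ {K A B : Type*} [CommRing K] [CommRing A] [CommRing B]
    [Algebra K B] (φ : A →+* B) (D : Derivation K B B) (hD : ∀ a, D (φ a) = 0) (b : B)
    (g : Polynomial A) :
    D (g.eval₂ φ b) = g.derivative.eval₂ φ b * D b := by
  induction g using Polynomial.induction_on' with
  | add p q hp hq => simp [Polynomial.eval₂_add, hp, hq, add_mul]
  | monomial m a =>
    simp [Polynomial.derivative_monomial, Polynomial.eval₂_monomial, hD, Derivation.leibniz_pow]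
    ring

/-- A derivation of a domain `B` that vanishes on a subring over which the fraction field of `B`
is separable is zero. -/
theorem Derivation.eq_zero_of_isSeparable {K A B F L : Type*} [CommRing K] [CommRing A]
    [IsDomain A] [CommRing B] [IsDomain B] [Algebra K B] [Field F] [Field L]
    [Algebra A F] [IsFractionRing A F] [Algebra B L] [IsFractionRing B L]
    (φ : A →+* B) (j : F →+* L)
    (hj : ∀ a, j (algebraMap A F a) = algebraMap B L (φ a))
    (hsep : letI := j.toAlgebra; Algebra.IsSeparable F L)
    (D : Derivation K B B) (hD : ∀ a, D (φ a) = 0) (b : B) : D b = 0 := by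
  let := j.toAlgebra
  have hinj := IsFractionRing.injective B L
  have hs : (minpoly F (algebraMap B L b)).Separable := Algebra.IsSeparable.isSeparable F _
  set f := minpoly F (algebraMap B L b) with hf
  obtain ⟨c, hcM, hc⟩ := IsLocalization.integerNormalization_spec (nonZeroDivisors A) f
  set g := IsLocalization.integerNormalization (nonZeroDivisors A) f
  have hc0 : algebraMap A F c ≠ 0 := IsFractionRing.to_map_ne_zero_of_mem_nonZeroDivisors hcM
  have hc' : g.map (algebraMap A F) = Polynomial.C (algebraMap A F c) * f := by
    rw [hc, ← Polynomial.smul_eq_C_mul]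
    ext i
    simp [Algebra.smul_def]
  have key : ∀ p : Polynomial A, algebraMap B L (p.eval₂ φ b) =
      Polynomial.aeval (algebraMap B L b) (p.map (algebraMap A F)) := by
    intro p
    rw [Polynomial.hom_eval₂, Polynomial.aeval_def, Polynomial.eval₂_map]
    congr 1
    ext a
    exact (hj a).symm
  have h0 : g.eval₂ φ b = 0 := by
    apply hinj
    rw [key, hc', map_mul, hf, minpoly.aeval, mul_zero, map_zero]
  have h1 : g.derivative.eval₂ φ b ≠ 0 := by
    intro h
    have h2 := key g.derivative
    rw [h, ← Polynomial.derivative_map, hc', Polynomial.derivative_C_mul, map_mul,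
      Polynomial.aeval_C, map_zero, eq_comm, mul_eq_zero] at h2
    rcases h2 with h2 | h2
    · exact hc0 ((map_eq_zero _).1 h2)
    · exact hs.aeval_derivative_ne_zero (minpoly.aeval _ _) h2
  have h2 := D.leibniz_eval₂ φ hD b g
  rw [h0, map_zero, eq_comm, mul_eq_zero] at h2
  exact h2.resolve_left h1

theorem MvPolynomial.derivation_aeval_eq_zero {K B σ : Type*} [CommRing K] [CommRing B]
    [Algebra K B] (P : σ → B) (D : Derivation K B B) (hD : ∀ i, D (P i) = 0)
    (a : MvPolynomial σ K) : D (aeval P a) = 0 := by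
  induction a using MvPolynomial.induction_on with
  | C r => simp
  | add p q hp hq => simp [hp, hq]
  | mul_X p i hp => simp [hp, hD]

/-- A nonzero polynomial is nonzero at infinitely many points of a power of an infinite set. -/
theorem MvPolynomial.infinite_setOf_eval_ne_zero {K T σ : Type*} [CommRing K] [IsDomain K]
    [Infinite T] [Finite σ] [Nonempty σ] (ι : T → K) (hι : Function.Injective ι)
    {G : MvPolynomial σ K} (hG : G ≠ 0) :
    {a : σ → T | eval (fun i => ι (a i)) G ≠ 0}.Infinite := by
  intro hfin
  apply hG
  set U := {a : σ → T | eval (fun i => ι (a i)) G ≠ 0}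
  have hs (i : σ) : (ι '' ((fun a : σ → T => a i) '' U)ᶜ).Infinite :=
    (hfin.image _).infinite_compl.image hι.injOn
  refine MvPolynomial.funext_set _ hs fun x hx => ?_
  choose a ha hax using fun i => hx i (Set.mem_univ i)
  obtain rfl : (fun i => ι (a i)) = x := _root_.funext hax
  rw [map_zero]
  by_contra hne
  exact ha (Classical.arbitrary σ) ⟨a, hne, rfl⟩

/-- For `K = k((t))` and `P₁,…,Pₙ ∈ K[x₁,…,xₙ]` defining a finite, separable self-map of
affine `n`-space, there are infinitely many tuples `(a₁,…,aₙ)` with `aᵢ ∈ k[[t]]` such that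
every solution `x ∈ K̄ⁿ` of `Pᵢ(x) = t·aᵢ` (for all `i`) has nonvanishing Jacobian
determinant `det(∂Pᵢ/∂xⱼ(x))`. -/
theorem stmt_2 {k : Type*} [Field k] {n : ℕ} (hn : 1 ≤ n)
    (P : Fin n → MvPolynomial (Fin n) (LaurentSeries k))
    (hinj : Function.Injective
      (aeval P : MvPolynomial (Fin n) (LaurentSeries k) →ₐ[LaurentSeries k]
        MvPolynomial (Fin n) (LaurentSeries k)))
    (hfin : Module.Finite
      (↥(aeval P : MvPolynomial (Fin n) (LaurentSeries k) →ₐ[LaurentSeries k]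
          MvPolynomial (Fin n) (LaurentSeries k)).range)
      (MvPolynomial (Fin n) (LaurentSeries k)))
    (hsep :
      letI : Algebra (FractionRing (MvPolynomial (Fin n) (LaurentSeries k)))
          (FractionRing (MvPolynomial (Fin n) (LaurentSeries k))) :=
        (IsFractionRing.lift
          (g := (algebraMap (MvPolynomial (Fin n) (LaurentSeries k))
              (FractionRing (MvPolynomial (Fin n) (LaurentSeries k)))).comp
            (aeval P : MvPolynomial (Fin n) (LaurentSeries k) →ₐ[LaurentSeries k]
              MvPolynomial (Fin n) (LaurentSeries k)).toRingHom)
          ((IsFractionRing.injective (MvPolynomial (Fin n) (LaurentSeries k))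
            (FractionRing (MvPolynomial (Fin n) (LaurentSeries k)))).comp hinj)).toAlgebra
      Algebra.IsSeparable (FractionRing (MvPolynomial (Fin n) (LaurentSeries k)))
        (FractionRing (MvPolynomial (Fin n) (LaurentSeries k)))) :
    {a : Fin n → PowerSeries k |
      ∀ x : Fin n → AlgebraicClosure (LaurentSeries k),
        (∀ i, aeval x (P i) =
          algebraMap (LaurentSeries k) (AlgebraicClosure (LaurentSeries k))
            (algebraMap (PowerSeries k) (LaurentSeries k) (PowerSeries.X * a i))) →
        Matrix.det (Matrix.of fun i j => aeval x (pderiv j (P i))) ≠ 0}.Infinite := by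
  have hJ : (Matrix.of fun i j => pderiv j (P i)).det ≠ 0 := by
    intro h0
    obtain ⟨v, hv, hMv⟩ := Matrix.exists_mulVec_eq_zero_iff.2 h0
    let D : Derivation (LaurentSeries k) (MvPolynomial (Fin n) (LaurentSeries k))
      (MvPolynomial (Fin n) (LaurentSeries k)) := ∑ j, v j • pderiv j
    have hDapp (p) : D p = ∑ j, v j * pderiv j p := by
      have h := congrFun (map_sum (Derivation.coeFnAddMonoidHom (R := LaurentSeries k)
        (A := MvPolynomial (Fin n) (LaurentSeries k))
        (M := MvPolynomial (Fin n) (LaurentSeries k)))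
        (fun j => v j • pderiv j) Finset.univ) p
      exact h.trans (by simp [Finset.sum_apply])
    have hDP (i) : D (P i) = 0 := by
      rw [hDapp]
      simpa [Matrix.mulVec, dotProduct, mul_comm] using congrFun hMv i
    apply hv
    ext1 i
    have hDX := Derivation.eq_zero_of_isSeparable _ _
      (fun a => IsFractionRing.lift_algebraMap _ a) hsep D
      (fun a => derivation_aeval_eq_zero P D hDP a) (X i)
    simpa [hDapp, pderiv_X, Pi.single_apply] using hDX
  obtain ⟨⟨_, G, rfl⟩, hs0, hdvd⟩ :=
    (Algebra.IsAlgebraic.isAlgebraic (R := (aeval P : MvPolynomial (Fin n) (LaurentSeries k)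
      →ₐ[LaurentSeries k] MvPolynomial (Fin n) (LaurentSeries k)).range)
      (Matrix.of fun i j => pderiv j (P i)).det).exists_nonzero_dvd
      (mem_nonZeroDivisors_of_ne_zero hJ)
  have hG : G ≠ 0 := by
    rintro rfl
    exact hs0 (Subtype.ext (map_zero _))
  have : Nonempty (Fin n) := ⟨⟨0, hn⟩⟩
  have hι : Function.Injective fun a : PowerSeries k =>
      algebraMap (PowerSeries k) (LaurentSeries k) (PowerSeries.X * a) :=
    (IsFractionRing.injective (PowerSeries k) (LaurentSeries k)).comp
      (mul_right_injective₀ PowerSeries.X_ne_zero)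
  have : Infinite (PowerSeries k) :=
    Infinite.of_injective (fun m : ℕ => (PowerSeries.X : PowerSeries k) ^ m) fun m m' h => by
      simpa using congrArg PowerSeries.order h
  refine Set.Infinite.mono (fun a ha x hx hdet => ?_) (infinite_setOf_eval_ne_zero _ hι hG)
  refine ha ?_
  obtain ⟨Q, hQ⟩ := hdvd
  have hx' := congrArg (aeval x) hQ
  have hdet' : aeval x (Matrix.of fun i j => pderiv j (P i)).det = 0 := by
    rw [AlgHom.map_det, ← hdet]
    rfl
  rw [map_mul, hdet', zero_mul] at hx'
  apply (algebraMap (LaurentSeries k) (AlgebraicClosure (LaurentSeries k))).injective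
  rw [map_zero, ← hx']
  change _ = aeval x (aeval P G)
  rw [← AlgHom.comp_apply, comp_aeval, _root_.funext hx]
  exact eval₂_comp _ _ _
end

section
/- Let k be a field with algebraic closure k̄, let f ∈ k[x_1,…,x_n] be a polynomial of total degree d ≥ 1, and let f_d denote its degree-d homogeneous component. Assume: (i) the only common zero in k̄^n of the partial derivatives ∂f_d/∂x_1,…,∂f_d/∂x_n is the origin; (ii) the k-algebra endomorphism of k[x_1,…,x_n] sending x_i to ∂f/∂x_i is injective, makes k[x_1,…,x_n] a finitely generated module over its image, and induces a separable extension of fraction fields. Let A be the set of multi-indices α with |α| < d. Then there exists a nonzero polynomial Q in the variables (c_α)_{α∈A} with coefficients in k[[t]] such that: for every family (c_α)_{α∈A} of elements of k[[t]] with Q((c_α)) ≠ 0, setting g = Σ_{α∈A} c_α x^α ∈ k[[t]][x_1,…,x_n], every common zero x ∈ K̄^n (K̄ an algebraic closure of k((t))) of the partial derivatives ∂(f+tg)/∂x_1,…,∂(f+tg)/∂x_n satisfies det(∂²(f+tg)/∂x_i∂x_j(x))_{i,j=1}^n ≠ 0. -/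
open MvPolynomial

set_option maxHeartbeats 2000000
set_option synthInstance.maxHeartbeats 1000000

/-- The deformation `f + t·g`, with coefficients pushed into an algebraic closure `K̄` of
`k((t))`. -/
noncomputable def deformedPoly {k : Type*} [Field k] {n : ℕ} (f : MvPolynomial (Fin n) k)
    (g : MvPolynomial (Fin n) (PowerSeries k)) :
    MvPolynomial (Fin n) (AlgebraicClosure (LaurentSeries k)) :=
  MvPolynomial.map
    ((algebraMap (LaurentSeries k) (AlgebraicClosure (LaurentSeries k))).comp
      (algebraMap (PowerSeries k) (LaurentSeries k)))
    (MvPolynomial.map (algebraMap k (PowerSeries k)) f + MvPolynomial.C PowerSeries.X * g)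

/-- Any `|ι|` elements of a polynomial ring in `|ι|` variables over a field are algebraically
dependent modulo a nonzero polynomial `δ`. -/
theorem exists_ne_zero_dvd_aeval {K ι : Type*} [Field K] [Finite ι] {δ : MvPolynomial ι K}
    (hδ : δ ≠ 0) (φ : ι → MvPolynomial ι K) :
    ∃ q : MvPolynomial ι K, q ≠ 0 ∧ δ ∣ aeval φ q := by
  by_cases hφ : AlgebraicIndependent K φ
  · have hopt : ¬ AlgebraicIndependent K (fun o : Option ι => o.elim δ φ) := by
      intro h
      have h1 := h.lift_cardinalMk_le_trdeg
      rw [MvPolynomial.trdeg_of_isDomain, Cardinal.mk_option] at h1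
      have := Fintype.ofFinite ι
      simp only [Cardinal.mk_fintype, Cardinal.lift_add, Cardinal.lift_natCast,
        Cardinal.lift_one] at h1
      exact absurd h1 (by exact_mod_cast Nat.not_succ_le_self _)
    rw [hφ.option_iff_transcendental] at hopt
    obtain ⟨⟨r, hr⟩, hr0, hdvd⟩ :=
      (not_not.mp hopt : IsAlgebraic _ δ).exists_nonzero_dvd (mem_nonZeroDivisors_of_ne_zero hδ)
    have hr' := hr
    rw [Algebra.adjoin_range_eq_range_aeval] at hr'
    obtain ⟨q, rfl⟩ := hr'
    refine ⟨q, ?_, hdvd⟩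
    rintro rfl
    exact hr0 (Subtype.ext (map_zero _))
  · rw [algebraicIndependent_iff] at hφ
    push Not at hφ
    obtain ⟨q, hq, hq0⟩ := hφ
    exact ⟨q, hq0, hq ▸ dvd_zero δ⟩

theorem Derivation.map_eval₂_of_comp_eq_zero {k A B : Type*} [CommRing k] [CommRing A] [Algebra k A]
    [CommRing B] (D : Derivation k A A) (φ : B →+* A) (h : ∀ b, D (φ b) = 0) (a : A)
    (P : Polynomial B) :
    D (P.eval₂ φ a) = P.derivative.eval₂ φ a * D a := by
  induction P using Polynomial.induction_on' with
  | add p q hp hq => simp [Polynomial.eval₂_add, hp, hq, add_mul]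
  | monomial m b =>
    simp [Polynomial.eval₂_monomial, Polynomial.derivative_monomial, h, D.leibniz_pow]
    ring

/-- If the gradient map of `f` induces a separable extension of fraction fields, the Hessian
determinant of `f` is not the zero polynomial. -/
theorem det_hessian_ne_zero_of_isSeparable {k E L σ : Type*} [Field k] [Field E] [Field L]
    [Fintype σ] [DecidableEq σ] [Algebra (MvPolynomial σ k) E]
    [IsFractionRing (MvPolynomial σ k) E] [Algebra (MvPolynomial σ k) L]
    (hL : Function.Injective (algebraMap (MvPolynomial σ k) L))
    [Algebra E L] [Algebra.IsSeparable E L] (f : MvPolynomial σ k)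
    (h : ∀ p : MvPolynomial σ k, algebraMap E L (algebraMap _ E p) =
      algebraMap _ L (aeval (fun i => pderiv i f) p)) :
    Matrix.det (Matrix.of fun i j => pderiv j (pderiv i f)) ≠ 0 := by
  intro hdet
  obtain ⟨v, hv, hHv⟩ := Matrix.exists_mulVec_eq_zero_iff.mpr hdet
  let φ : MvPolynomial σ k →+* MvPolynomial σ k :=
    (aeval (fun i => pderiv i f) : MvPolynomial σ k →ₐ[k] MvPolynomial σ k).toRingHom
  let D : Derivation k (MvPolynomial σ k) (MvPolynomial σ k) := mkDerivation k v
  have hD : ∀ p, D p = ∑ j, pderiv j p * v j := by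
    intro p
    induction p using MvPolynomial.induction_on with
    | C a => simp
    | add p q hp hq => simp [hp, hq, add_mul, Finset.sum_add_distrib]
    | mul_X p i hp =>
      have hX : D (X i) = v i := mkDerivation_X ..
      simp [hp, hX, add_mul, Finset.sum_add_distrib, pderiv_X, Pi.single_apply, Finset.mul_sum,
        mul_assoc]
  have hDf : ∀ i, D (pderiv i f) = 0 := by
    intro i
    rw [hD]
    simpa [Matrix.mulVec, dotProduct] using congrFun hHv i
  have hDφ : ∀ p, D (φ p) = 0 := by
    intro p
    change D (aeval _ p) = 0
    induction p using MvPolynomial.induction_on with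
    | C a => simp
    | add p q hp hq => rw [map_add, map_add, hp, hq, add_zero]
    | mul_X p i hp => rw [map_mul, aeval_X, D.leibniz, hp, hDf, smul_zero, smul_zero, add_zero]
  refine hv (funext fun j => ?_)
  have hs : IsSeparable E (algebraMap (MvPolynomial σ k) L (X j)) :=
    Algebra.IsSeparable.isSeparable E _
  let p := minpoly E (algebraMap (MvPolynomial σ k) L (X j))
  obtain ⟨b, hbM, hb⟩ := IsLocalization.integerNormalization_spec
    (nonZeroDivisors (MvPolynomial σ k)) p
  set P := IsLocalization.integerNormalization (nonZeroDivisors (MvPolynomial σ k)) p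
  have hbE : algebraMap (MvPolynomial σ k) E b ≠ 0 :=
    IsLocalization.to_map_ne_zero_of_mem_nonZeroDivisors E le_rfl hbM
  have hb' : P.map (algebraMap _ E) = Polynomial.C (algebraMap _ E b) * p := by
    rw [hb, ← Polynomial.smul_eq_C_mul, algebraMap_smul]
  have key : ∀ R : Polynomial (MvPolynomial σ k),
      algebraMap _ L (R.eval₂ φ (X j)) =
        Polynomial.aeval (algebraMap (MvPolynomial σ k) L (X j)) (R.map (algebraMap _ E)) := by
    intro R
    rw [Polynomial.hom_eval₂, Polynomial.aeval_def, Polynomial.eval₂_map]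
    congr 1
    exact RingHom.ext fun p => (h p).symm
  have h0 : P.eval₂ φ (X j) = 0 := by
    apply hL
    rw [key, hb', map_mul, minpoly.aeval, mul_zero, map_zero]
  have h1 : P.derivative.eval₂ φ (X j) ≠ 0 := by
    intro h1
    have h2 := key P.derivative
    rw [h1, map_zero, ← Polynomial.derivative_map, hb', Polynomial.derivative_C_mul, map_mul,
      Polynomial.aeval_C, eq_comm, mul_eq_zero] at h2
    rcases h2 with h2 | h2
    · exact hbE ((algebraMap E L).injective (by rw [h2, map_zero]))
    · exact hs.aeval_derivative_ne_zero (minpoly.aeval _ _) h2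
  have h2 := D.map_eval₂_of_comp_eq_zero φ hDφ (X j) P
  rw [h0, map_zero, eq_comm, mul_eq_zero] at h2
  simpa [D] using h2.resolve_left h1

theorem map_eval_pderiv_pderiv {R S σ : Type*} [CommRing R] [CommRing S] (ψ : R →+* S) (x : σ → R)
    (p : MvPolynomial σ R) (i j : σ) :
    ψ (eval x (pderiv j (pderiv i p))) =
      eval (ψ ∘ x) (pderiv j (pderiv i (map ψ p))) := by
  rw [pderiv_map, pderiv_map, map_eval]

theorem map_det_hessian {R S σ : Type*} [Fintype σ] [DecidableEq σ] [CommRing R] [CommRing S]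
    (ψ : R →+* S) (x : σ → R) (p : MvPolynomial σ R) :
    ψ (Matrix.det (Matrix.of fun i j => eval x (pderiv j (pderiv i p)))) =
      Matrix.det (Matrix.of fun i j => eval (ψ ∘ x) (pderiv j (pderiv i (map ψ p)))) := by
  rw [RingHom.map_det]
  congr 1
  ext i j
  exact map_eval_pderiv_pderiv ψ x p i j

/-- If the Hessian determinant of `F` is not the zero polynomial, then the generic member of the
family `F + t • (∑ a, c a • m a + ∑ i, c i • X i)` has only nondegenerate critical points: the
critical equations express the linear coefficients through the other coefficients and the critical
point, so the coefficients of a member with a degenerate critical point are algebraically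
dependent. -/
theorem exists_ne_zero_forall_det_hessian_ne_zero {K σ τ : Type*} [Field K] [Fintype σ]
    [DecidableEq σ] [Fintype τ] {t : K} (ht : t ≠ 0) (F : MvPolynomial σ K)
    (hF : Matrix.det (Matrix.of fun i j => pderiv j (pderiv i F)) ≠ 0)
    (m : τ → MvPolynomial σ K) (L : Type*) [Field L] [Algebra K L] :
    ∃ q : MvPolynomial (τ ⊕ σ) K, q ≠ 0 ∧
      ∀ (c : τ ⊕ σ → K) (G : MvPolynomial σ K), eval c q ≠ 0 →
        G = F + C t * (∑ a, C (c (Sum.inl a)) * m a + ∑ i, C (c (Sum.inr i)) * X i) →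
        ∀ x : σ → L, (∀ i, eval x (pderiv i (map (algebraMap K L) G)) = 0) →
          Matrix.det (Matrix.of fun i j =>
            eval x (pderiv j (pderiv i (map (algebraMap K L) G)))) ≠ 0 := by
  let A := MvPolynomial (τ ⊕ σ) K
  let G₀ : MvPolynomial σ A :=
    map C F + C (C t) * ∑ a, C (X (Sum.inl a)) * map C (m a)
  let ξ : σ → A := fun i => X (Sum.inr i)
  let δ : A := Matrix.det (Matrix.of fun i j => eval ξ (pderiv j (pderiv i G₀)))
  let φ : τ ⊕ σ → A :=
    Sum.elim (fun a => X (Sum.inl a)) fun i => -C t⁻¹ * eval ξ (pderiv i G₀)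
  have hδ : δ ≠ 0 := by
    intro h0
    let ψ : A →+* MvPolynomial σ K := (aeval (Sum.elim 0 X) : A →ₐ[K] MvPolynomial σ K).toRingHom
    have hψC : ψ.comp C = C := by ext a; simp [ψ, A, algebraMap_eq]
    have hψG : map ψ G₀ = map C F := by
      have hX : ∀ a, ψ (X (Sum.inl a)) = 0 := fun a => aeval_X _ _
      simp [G₀, map_map, hψC, hX]
    have hψξ : ψ ∘ ξ = X := funext fun i => aeval_X _ _
    have h := map_det_hessian ψ ξ G₀
    rw [show Matrix.det _ = (0 : A) from h0, map_zero, hψG, hψξ] at h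
    refine hF ?_
    rw [h]
    congr 1
    ext1 i j
    simp only [Matrix.of_apply, pderiv_map, eval_map, eval₂_eta]
  obtain ⟨q, hq0, hq⟩ := exists_ne_zero_dvd_aeval hδ φ
  refine ⟨q, hq0, fun c G hc hG x hx hdet => ?_⟩
  let ψ : A →ₐ[K] L := aeval (Sum.elim (fun a => algebraMap K L (c (Sum.inl a))) x)
  have hψC : (ψ : A →+* L).comp C = algebraMap K L := by ext a; simp [ψ, A]
  have hψG : map (algebraMap K L) G = map (ψ : A →+* L) G₀ +
      C (algebraMap K L t) * ∑ i, C (algebraMap K L (c (Sum.inr i))) * X i := by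
    have hCt : ψ (C t) = algebraMap K L t := RingHom.congr_fun hψC t
    have hX : ∀ a, ψ (X (Sum.inl a)) = algebraMap K L (c (Sum.inl a)) := fun a => aeval_X _ _
    simp only [hG, G₀, map_add, map_mul, map_sum, map_C, map_X, map_map, hψC, RingHom.coe_coe,
      hCt, hX]
    ring
  have hψξ : (ψ : A →+* L) ∘ ξ = x := funext fun i => aeval_X _ _
  have hd1 : ∀ i, pderiv i (map (algebraMap K L) G) = pderiv i (map (ψ : A →+* L) G₀) +
      C (algebraMap K L t * algebraMap K L (c (Sum.inr i))) := by
    intro i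
    simp [hψG, map_sum, pderiv_X, Pi.single_apply]
  have hψφ : ψ.comp (aeval φ) = (aeval (fun s => algebraMap K L (c s)) : A →ₐ[K] L) := by
    ext s
    rcases s with a | i
    · rw [AlgHom.comp_apply, aeval_X, aeval_X]
      exact aeval_X _ _
    · have h1 := hx i
      rw [hd1, map_add, eval_C] at h1
      have h2 : ψ (eval ξ (pderiv i G₀)) = eval x (pderiv i (map (ψ : A →+* L) G₀)) := by
        rw [← hψξ, pderiv_map, ← map_eval]; rfl
      have h3 : ψ (C t⁻¹) = (algebraMap K L t)⁻¹ := by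
        rw [← map_inv₀]; exact RingHom.congr_fun hψC t⁻¹
      have ht' : algebraMap K L t ≠ 0 := by simpa using ht
      simp only [AlgHom.comp_apply, aeval_X, φ, Sum.elim_inr, map_mul, map_neg, h2, h3]
      rw [eq_neg_of_add_eq_zero_left h1]
      field_simp
  have hψδ : ψ δ = 0 := by
    have h := map_det_hessian (ψ : A →+* L) ξ G₀
    rw [hψξ] at h
    refine h.trans (Eq.trans ?_ hdet)
    congr 1
    ext1 i j
    simp only [Matrix.of_apply, hd1, map_add, pderiv_C, add_zero]
  have h1 : ψ (aeval φ q) = 0 := by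
    obtain ⟨r, hr⟩ := hq
    rw [hr, map_mul, hψδ, zero_mul]
  rw [← AlgHom.comp_apply, hψφ] at h1
  refine hc ((algebraMap K L).injective ?_)
  rw [map_zero, ← h1, map_eval, aeval_def, eval_map]
  rfl

/-- Clearing denominators turns a genericity condition over the fraction field into one over the
ring. -/
theorem exists_ne_zero_eval_ne_zero_of_isFractionRing {R K ι : Type*} [CommRing R] [IsDomain R]
    [Field K] [Algebra R K] [IsFractionRing R K] {q : MvPolynomial ι K} (hq : q ≠ 0) :
    ∃ Q : MvPolynomial ι R, Q ≠ 0 ∧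
      ∀ c : ι → R, eval c Q ≠ 0 → eval (fun i => algebraMap R K (c i)) q ≠ 0 := by
  let : Algebra (MvPolynomial ι R) (MvPolynomial ι K) := algebraMvPolynomial
  obtain ⟨⟨Q, b⟩, hQ⟩ := IsLocalization.surj ((nonZeroDivisors R).map (C (σ := ι))) q
  obtain ⟨_, r, hr, rfl⟩ := b
  have hr' : algebraMap R K r ≠ 0 :=
    IsLocalization.to_map_ne_zero_of_mem_nonZeroDivisors K le_rfl hr
  simp only [algebraMap_def, map_C] at hQ
  refine ⟨Q, ?_, fun c hc h0 => hc (IsFractionRing.injective R K ?_)⟩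
  · rintro rfl
    rw [map_zero] at hQ
    exact mul_ne_zero hq (by simpa using hr') hQ
  · have h := congrArg (eval fun i => algebraMap R K (c i)) hQ
    rw [map_mul, h0, zero_mul] at h
    rw [map_zero, h, map_eval]
    rfl

theorem one_lt_totalDegree_of_injective_aeval_pderiv {k : Type*} [Field k] {n d : ℕ}
    (f : MvPolynomial (Fin n) k) (hd : 1 ≤ d) (hdeg : f.totalDegree = d)
    (hinj : Function.Injective
      (aeval (fun i => pderiv i f) : MvPolynomial (Fin n) k →ₐ[k] MvPolynomial (Fin n) k)) :
    1 < d := by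
  refine lt_of_le_of_ne hd fun h1 => ?_
  subst h1
  have hn : Nonempty (Fin n) := by
    by_contra hn
    rw [not_nonempty_iff] at hn
    rw [eq_C_of_isEmpty f, totalDegree_C] at hdeg
    omega
  obtain ⟨i⟩ := hn
  obtain ⟨a, ha⟩ : ∃ a, pderiv i f = C a := by
    refine ⟨coeff (Finsupp.single i 1) f, MvPolynomial.ext _ _ fun m => ?_⟩
    rw [coeff_pderiv, coeff_C]
    split_ifs with hm
    · simp [← hm]
    · have hlt : f.totalDegree < (m + Finsupp.single i 1).degree := by
        rw [hdeg, map_add, Finsupp.degree_single]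
        have := (Finsupp.degree_eq_zero_iff m).not.mpr (Ne.symm hm)
        omega
      rw [coeff_eq_zero_of_totalDegree_lt hlt, zero_mul]
  have h2 : (X i : MvPolynomial (Fin n) k) = C a := hinj (by
    rw [aeval_X, ha, ← algebraMap_eq, AlgHom.commutes])
  have h3 := congrArg totalDegree h2
  rw [totalDegree_X, totalDegree_C] at h3
  omega

/-- For `f` of degree `d ≥ 1` whose top-degree part has no critical points at infinity and
whose gradient map is finite and separable, a generic polynomial `g` of degree `< d` with
`k[[t]]` coefficients (genericity expressed by nonvanishing of a nonzero polynomial `Q` in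
the coefficients `(c_α)_{|α|<d}` of `g`) has the property that every critical point of
`f + t·g` over an algebraic closure of `k((t))` has nonvanishing Hessian determinant,
i.e. all singularities of the deformed family are nodes. -/
theorem stmt_5 {k : Type*} [Field k] {n : ℕ} (f : MvPolynomial (Fin n) k) (d : ℕ)
    (hd : 1 ≤ d) (hdeg : f.totalDegree = d)
    (hinfty : ∀ x : Fin n → AlgebraicClosure k,
      (∀ i, aeval x (pderiv i (homogeneousComponent d f)) = 0) → x = 0)
    (hinj : Function.Injective
      (aeval (fun i => pderiv i f) : MvPolynomial (Fin n) k →ₐ[k] MvPolynomial (Fin n) k))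
    (hfin : Module.Finite
      (↥(aeval (fun i => pderiv i f) :
          MvPolynomial (Fin n) k →ₐ[k] MvPolynomial (Fin n) k).range)
      (MvPolynomial (Fin n) k))
    (hsep :
      letI : Algebra (FractionRing (MvPolynomial (Fin n) k))
          (FractionRing (MvPolynomial (Fin n) k)) :=
        (IsFractionRing.lift
          (g := (algebraMap (MvPolynomial (Fin n) k)
              (FractionRing (MvPolynomial (Fin n) k))).comp
            (aeval (fun i => pderiv i f) :
              MvPolynomial (Fin n) k →ₐ[k] MvPolynomial (Fin n) k).toRingHom)
          ((IsFractionRing.injective (MvPolynomial (Fin n) k)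
            (FractionRing (MvPolynomial (Fin n) k))).comp hinj)).toAlgebra
      Algebra.IsSeparable (FractionRing (MvPolynomial (Fin n) k))
        (FractionRing (MvPolynomial (Fin n) k))) :
    ∃ Q : MvPolynomial {α : Fin n →₀ ℕ // (α.sum fun _ e => e) < d} (PowerSeries k),
      Q ≠ 0 ∧
      ∀ g : MvPolynomial (Fin n) (PowerSeries k), g.totalDegree < d →
        MvPolynomial.eval (fun α => MvPolynomial.coeff α.1 g) Q ≠ 0 →
        ∀ x : Fin n → AlgebraicClosure (LaurentSeries k),
          (∀ i, MvPolynomial.eval x (pderiv i (deformedPoly f g)) = 0) →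
          Matrix.det (Matrix.of fun i j =>
            MvPolynomial.eval x (pderiv j (pderiv i (deformedPoly f g)))) ≠ 0 := by
  have hd1 : 1 < d := one_lt_totalDegree_of_injective_aeval_pderiv f hd hdeg hinj
  have hH : Matrix.det (Matrix.of fun i j => pderiv j (pderiv i f)) ≠ 0 := by
    let : Algebra (FractionRing (MvPolynomial (Fin n) k))
        (FractionRing (MvPolynomial (Fin n) k)) :=
      (IsFractionRing.lift
        (g := (algebraMap (MvPolynomial (Fin n) k)
            (FractionRing (MvPolynomial (Fin n) k))).comp
          (aeval (fun i => pderiv i f) :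
            MvPolynomial (Fin n) k →ₐ[k] MvPolynomial (Fin n) k).toRingHom)
        ((IsFractionRing.injective (MvPolynomial (Fin n) k)
          (FractionRing (MvPolynomial (Fin n) k))).comp hinj)).toAlgebra
    exact @det_hessian_ne_zero_of_isSeparable k (FractionRing (MvPolynomial (Fin n) k))
      (FractionRing (MvPolynomial (Fin n) k)) (Fin n) _ _ _ _ _ _ _ _
      (IsFractionRing.injective _ _) this hsep f (fun p => IsFractionRing.lift_algebraMap _ p)
  let K := LaurentSeries k
  let ι₀ : PowerSeries k →+* K := algebraMap (PowerSeries k) K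
  have hι₀ : Function.Injective ι₀ := IsFractionRing.injective (PowerSeries k) K
  let t : K := ι₀ PowerSeries.X
  have ht : t ≠ 0 := by
    rw [← map_zero ι₀]
    exact hι₀.ne PowerSeries.X_ne_zero
  let κ : k →+* K := ι₀.comp (algebraMap k (PowerSeries k))
  let F : MvPolynomial (Fin n) K := map κ f
  have hF : Matrix.det (Matrix.of fun i j => pderiv j (pderiv i F)) ≠ 0 := by
    have h : (Matrix.of fun i j => pderiv j (pderiv i F)) =
        (map κ : MvPolynomial (Fin n) k →+* _).mapMatrix
          (Matrix.of fun i j => pderiv j (pderiv i f)) := by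
      ext1 i j
      simp [F, pderiv_map]
    rw [h, ← RingHom.map_det]
    exact (map_ne_zero_iff _ (map_injective κ κ.injective)).mpr hH
  let S := {α : Fin n →₀ ℕ // (α.sum fun _ e => e) < d}
  have : Finite S := Finsupp.finite_of_degree_lt (σ := Fin n) d
  let lin : Fin n → S := fun i => ⟨Finsupp.single i 1, by simpa using hd1⟩
  have hlin : Function.Injective lin := fun i j hij =>
    Finsupp.single_left_injective one_ne_zero (congrArg Subtype.val hij)
  classical
  let τ := {s : S // s ∉ Set.range lin}
  have := Fintype.ofFinite S
  have := Fintype.ofFinite τ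
  let e : τ ⊕ Fin n ≃ S :=
    ((Equiv.sumCongr (Equiv.refl τ) (Equiv.ofInjective lin hlin)).trans (Equiv.sumComm _ _)).trans
      (Equiv.sumCompl (· ∈ Set.range lin))
  obtain ⟨q, hq0, hq⟩ := exists_ne_zero_forall_det_hessian_ne_zero ht F hF
    (fun a : τ => monomial (e (Sum.inl a)).1 1) (AlgebraicClosure K)
  obtain ⟨Q, hQ0, hQ⟩ := exists_ne_zero_eval_ne_zero_of_isFractionRing (R := PowerSeries k)
    ((map_ne_zero_iff _ (rename_injective e e.injective)).mpr hq0)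
  refine ⟨Q, hQ0, fun g hg hgQ x => ?_⟩
  let c : τ ⊕ Fin n → K := fun s => ι₀ (coeff (e s).1 g)
  have hgsum : map ι₀ g = ∑ s : S, C (ι₀ (coeff s.1 g)) * monomial s.1 1 := by
    ext1 α
    simp only [coeff_map, coeff_sum, coeff_C_mul, coeff_monomial, mul_ite, mul_one, mul_zero]
    by_cases hα : (α.sum fun _ e => e) < d
    · rw [Finset.sum_eq_single ⟨α, hα⟩ (fun s _ hs => if_neg fun h => hs (Subtype.ext h))
        (by simp), if_pos rfl]
    · rw [coeff_eq_zero_of_totalDegree_lt (lt_of_lt_of_le hg (not_lt.mp hα)), map_zero]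
      symm
      refine Finset.sum_eq_zero fun s _ => if_neg fun h => hα ?_
      rw [← h]
      exact s.2
  have hgK : map ι₀ g = ∑ a, C (c (Sum.inl a)) * monomial (e (Sum.inl a)).1 1 +
      ∑ i, C (c (Sum.inr i)) * X i := by
    rw [hgsum, ← e.sum_comp, Fintype.sum_sum_type]
    rfl
  have hdef : deformedPoly f g =
      map (algebraMap K (AlgebraicClosure K)) (F + C t * map ι₀ g) := by
    rw [deformedPoly, ← map_map, map_add, map_mul, map_C, map_map]
  rw [hdef]
  refine hq c _ ?_ (by rw [hgK]) x
  have h := hQ _ hgQ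
  rwa [eval_rename] at h
end

section
/- Let F_25 denote the field with 25 elements, viewed as a 2-dimensional vector space over its subfield F_5. The symmetric F_5-bilinear form B on F_25 defined by B(x,y) = Tr_{F_25/F_5}(−x·y) is not isometric to the bilinear form on (F_5)² with Gram matrix diag(1,−1). -/
instance : Fact (Nat.Prime 5) := ⟨by norm_num⟩

/-- The trace form on `𝔽₂₅` is anisotropic over `𝔽₅`. -/
theorem trace_mul_self_ne_zero {x : GaloisField 5 2} (hx : x ≠ 0) :
    Algebra.trace (ZMod 5) (GaloisField 5 2) (x * x) ≠ 0 := by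
  intro h
  let _ : Fintype (GaloisField 5 2) := Fintype.ofFinite _
  have hsum := FiniteField.algebraMap_trace_eq_sum_pow (ZMod 5) (GaloisField 5 2) (x * x)
  rw [h, GaloisField.finrank 5 two_ne_zero, map_zero] at hsum
  simp only [Nat.card_eq_fintype_card, ZMod.card, Finset.sum_range_succ, Finset.sum_range_zero,
    pow_zero, pow_one, zero_add] at hsum
  have h24 : x ^ 24 = 1 := by
    have := FiniteField.pow_card_sub_one_eq_one x hx
    rwa [← Nat.card_eq_fintype_card, GaloisField.card 5 2 two_ne_zero] at this
  have h8 : x ^ 8 = -1 := by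
    have : x * x * (1 + x ^ 8) = 0 := by linear_combination -hsum
    rcases mul_eq_zero.mp this with h0 | h0
    · exact absurd h0 (mul_ne_zero hx hx)
    · linear_combination h0
  have h2 : (2 : GaloisField 5 2) = 0 := by
    linear_combination (x ^ 16 - x ^ 8 + 1) * h8 - h24
  have h5 : (5 : GaloisField 5 2) = 0 := by
    exact_mod_cast CharP.cast_eq_zero (GaloisField 5 2) 5
  exact one_ne_zero (α := GaloisField 5 2) (by linear_combination h5 - 2 * h2)

/-- The symmetric `𝔽₅`-bilinear form `(x,y) ↦ Tr_{𝔽₂₅/𝔽₅}(-x·y)` on `𝔽₂₅` is not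
isometric to the hyperbolic form `diag(1,-1)` over `𝔽₅`. -/
theorem stmt_10 :
    ¬ ∃ e : GaloisField 5 2 ≃ₗ[ZMod 5] (Fin 2 → ZMod 5),
      ∀ x y : GaloisField 5 2,
        Algebra.trace (ZMod 5) (GaloisField 5 2) (-(x * y)) =
          e x 0 * e y 0 - e x 1 * e y 1 := by
  rintro ⟨e, he⟩
  have hx : e.symm (fun _ => 1) ≠ 0 := by
    rw [Ne, LinearEquiv.map_eq_zero_iff]
    exact fun h => one_ne_zero (congrFun h 0)
  apply trace_mul_self_ne_zero hx
  simpa using he (e.symm fun _ => 1) (e.symm fun _ => 1)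
end

section
/- Let k be an algebraically closed field of characteristic not 2 and not 3, and let t ∈ k be nonzero. Then there are exactly two triples (x_1, x_2, u) ∈ k³ such that the polynomial F = x_2² − x_1³ − t·x_1 − u and both of its partial derivatives ∂F/∂x_1 and ∂F/∂x_2 vanish at (x_1, x_2); moreover, at each such triple one has x_1 ≠ 0, so the Hessian determinant of F, which equals −12x_1, is nonzero there. -/
open MvPolynomial

/-- For fixed `t ≠ 0` over an algebraically closed field of characteristic not 2 or 3, the
family of curves `x₂² = x₁³ + t·x₁ + u` (parametrized by `u`) has exactly two singular
points `(x₁, x₂, u)`; at each of them `x₁ ≠ 0`, so the Hessian determinant `-12x₁` of the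
defining polynomial is nonzero there, i.e. both singularities are nodes. -/
theorem stmt_13 {k : Type*} [Field k] [IsAlgClosed k]
    (h2 : (2 : k) ≠ 0) (h3 : (3 : k) ≠ 0) (t : k) (ht : t ≠ 0) :
    let F : k → MvPolynomial (Fin 2) k := fun u =>
      (X 1) ^ 2 - (X 0) ^ 3 - C t * X 0 - C u
    let S : Set (k × k × k) := {p |
      eval ![p.1, p.2.1] (F p.2.2) = 0 ∧
      ∀ i : Fin 2, eval ![p.1, p.2.1] (pderiv i (F p.2.2)) = 0}
    S.ncard = 2 ∧
    ∀ p ∈ S, p.1 ≠ 0 ∧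
      Matrix.det (Matrix.of fun i j : Fin 2 =>
          eval ![p.1, p.2.1] (pderiv i (pderiv j (F p.2.2)))) = -12 * p.1 ∧
      Matrix.det (Matrix.of fun i j : Fin 2 =>
          eval ![p.1, p.2.1] (pderiv i (pderiv j (F p.2.2)))) ≠ 0 := by
  intro F S
  have hS : ∀ x y u : k, (x, y, u) ∈ S ↔ y = 0 ∧ 3 * x ^ 2 + t = 0 ∧ u = -x ^ 3 - t * x := by
    intro x y u
    simp only [S, F, Set.mem_ofPred_eq, Fin.forall_fin_two]
    simp [pderiv_X]
    constructor
    · rintro ⟨h, hx, hy⟩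
      have hy0 : y = 0 := by simpa [h2] using hy
      subst hy0
      exact ⟨rfl, by linear_combination -hx, by linear_combination -h⟩
    · rintro ⟨rfl, hx, rfl⟩
      exact ⟨by ring, by linear_combination -hx, Or.inr rfl⟩
  have hne : ∀ x : k, 3 * x ^ 2 + t = 0 → x ≠ 0 := by
    rintro x hx rfl
    exact ht (by linear_combination hx)
  have hdet : ∀ p : k × k × k, Matrix.det (Matrix.of fun i j : Fin 2 =>
      eval ![p.1, p.2.1] (pderiv i (pderiv j (F p.2.2)))) = -12 * p.1 := by
    intro p
    have hnum (n : ℕ) [n.AtLeastTwo] (i : Fin 2) :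
        pderiv i (ofNat(n) : MvPolynomial (Fin 2) k) = 0 :=
      (pderiv i).map_natCast n
    simp [F, Matrix.det_fin_two, pderiv_X, hnum]
    ring
  refine ⟨?_, ?_⟩
  · obtain ⟨a, ha⟩ := IsAlgClosed.exists_pow_nat_eq (-t / 3) (n := 2) two_pos
    have ha' : 3 * a ^ 2 + t = 0 := by
      rw [ha]
      field_simp
      ring
    have hSeq : S = {(a, 0, -a ^ 3 - t * a), (-a, 0, a ^ 3 + t * a)} := by
      ext ⟨x, y, u⟩
      rw [hS]
      simp only [Set.mem_insert_iff, Set.mem_singleton_iff, Prod.mk.injEq]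
      constructor
      · rintro ⟨rfl, hx, rfl⟩
        have hsq : x ^ 2 = a ^ 2 :=
          mul_left_cancel₀ h3 (by linear_combination hx - ha')
        rcases sq_eq_sq_iff_eq_or_eq_neg.mp hsq with rfl | rfl
        · exact Or.inl ⟨rfl, rfl, rfl⟩
        · exact Or.inr ⟨rfl, rfl, by ring⟩
      · rintro (⟨rfl, rfl, rfl⟩ | ⟨rfl, rfl, rfl⟩)
        · exact ⟨rfl, ha', rfl⟩
        · exact ⟨rfl, by linear_combination ha', by ring⟩
    rw [hSeq]
    refine Set.ncard_pair fun h => ?_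
    have haa : a = -a := congrArg Prod.fst h
    exact mul_ne_zero h2 (hne a ha') (by linear_combination haa)
  · rintro ⟨x, y, u⟩ hp
    have hx := hne x ((hS x y u).mp hp).2.1
    refine ⟨hx, hdet _, ?_⟩
    rw [hdet]
    have h12 : (-12 : k) ≠ 0 := by
      rw [show (-12 : k) = -(2 * 2 * 3) by norm_num]
      exact neg_ne_zero.mpr (mul_ne_zero (mul_ne_zero h2 h2) h3)
    exact mul_ne_zero h12 hx
end
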